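/- Fix α > 1 and ε ∈ (0,1]. There exist constants c, C > 0 depending only on α and ε such that for all reals a, b with a² + b² = 1, all reals A > 0, and all integers N ≥ 1 with εA ≤ N ≤ A/ε, the spectral gap λ of the Metropolis chain on 𝓑_N = {−N+1,…,N}² for the probability measure π proportional to F_N(x₁,x₂) = (1 + A·|a·(x₁−1/2)/N + b·(x₂−1/2)/N|)^α satisfies c/N^{α+1} ≤ λ ≤ C/N^{α+1}. -/

import Mathlib

open Finset

/-- The probability measure on a finite box in `ℤ²` proportional to `F`. -/
noncomputable def metroPi2 (box : Finset (ℤ × ℤ)) (F : ℤ × ℤ → ℝ) (k : ℤ × ℤ) : ℝ :=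
  F k / ∑ l ∈ box, F l

/-- Dirichlet form of the Metropolis chain for the measure proportional to `F`
based on simple random walk: sum over unordered nearest-neighbor pairs of
`(u(k)-u(l))²·(1/4)·min{π(k),π(l)}`. -/
noncomputable def metroDirichlet2 (box : Finset (ℤ × ℤ)) (F : ℤ × ℤ → ℝ)
    (u : ℤ × ℤ → ℝ) : ℝ :=
  (∑ k ∈ box,
    if (k.1 + 1, k.2) ∈ box then
      (u (k.1 + 1, k.2) - u k) ^ 2 *
        (1 / 4 * min (metroPi2 box F k) (metroPi2 box F (k.1 + 1, k.2)))
    else 0) +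
  ∑ k ∈ box,
    if (k.1, k.2 + 1) ∈ box then
      (u (k.1, k.2 + 1) - u k) ^ 2 *
        (1 / 4 * min (metroPi2 box F k) (metroPi2 box F (k.1, k.2 + 1)))
    else 0

/-- Variance with respect to the measure proportional to `F`. -/
noncomputable def metroVar2 (box : Finset (ℤ × ℤ)) (F : ℤ × ℤ → ℝ)
    (u : ℤ × ℤ → ℝ) : ℝ :=
  ∑ k ∈ box,
    (u k - ∑ l ∈ box, u l * metroPi2 box F l) ^ 2 * metroPi2 box F k

/-- Spectral gap of the Metropolis chain:
`λ = inf { ℰ(u,u)/Var_π(u) : Var_π(u) ≠ 0 }`. -/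
noncomputable def metroGap2 (box : Finset (ℤ × ℤ)) (F : ℤ × ℤ → ℝ) : ℝ :=
  sInf {r : ℝ | ∃ u : ℤ × ℤ → ℝ, metroVar2 box F u ≠ 0 ∧
    r = metroDirichlet2 box F u / metroVar2 box F u}

/-- The affine form vanishing on a line through the centre of the box `{-N+1,…,N}²`. -/
noncomputable def centredForm (p q : ℝ) (k : ℤ × ℤ) : ℝ :=
  p * ((k.1 : ℝ) - 1 / 2) + q * ((k.2 : ℝ) - 1 / 2)

/-- Cauchy–Schwarz along a segment of integers, with conductances `min (f x) (f (x + 1))`. -/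
lemma sq_sub_le_sum_inv_mul_sum_min (f v : ℤ → ℝ) (hf : ∀ x, 0 < f x) (m n : ℤ) {i j : ℤ}
    (hi : i ∈ Icc m n) (hj : j ∈ Icc m n) :
    (v i - v j) ^ 2 ≤ (2 * ∑ x ∈ Icc m n, 1 / f x) *
      ∑ x ∈ Icc m n, if x + 1 ∈ Icc m n then
        (v (x + 1) - v x) ^ 2 * min (f x) (f (x + 1)) else 0 := by
  wlog hij : i ≤ j generalizing i j
  · have := this hj hi (by omega)
    rwa [← neg_sub, neg_sq] at this
  set J := (Icc m n).filter (fun x => x + 1 ∈ Icc m n) with hJ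
  have htel : ∀ d : ℕ, v (i + d) - v i = ∑ x ∈ Ico i (i + d), (v (x + 1) - v x) := by
    intro d
    induction d with
    | zero => simp
    | succ d ih =>
      have : Ico i (i + ((d + 1 : ℕ) : ℤ)) = insert (i + (d : ℤ)) (Ico i (i + d)) := by
        ext x; simp; omega
      rw [this, sum_insert (by simp), ← ih]
      push_cast
      rw [← add_assoc]
      ring
  have hsub : Ico i j ⊆ J := by
    intro x hx
    simp only [hJ, mem_filter, mem_Icc, mem_Ico] at *
    omega
  have habs : |v i - v j| ≤ ∑ x ∈ J, |v (x + 1) - v x| := by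
    have h := htel (j - i).toNat
    have e : i + ((j - i).toNat : ℤ) = j := by omega
    rw [e] at h
    rw [abs_sub_comm, h]
    exact (abs_sum_le_sum_abs _ _).trans
      (sum_le_sum_of_subset_of_nonneg hsub fun _ _ _ => abs_nonneg _)
  have hmin : ∀ x, 0 < min (f x) (f (x + 1)) := fun x => lt_min (hf _) (hf _)
  have hcs := sum_sq_le_sum_mul_sum_of_sq_le_mul J
    (r := fun x => |v (x + 1) - v x|)
    (f := fun x => 1 / min (f x) (f (x + 1)))
    (g := fun x => (v (x + 1) - v x) ^ 2 * min (f x) (f (x + 1)))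
    (fun x _ => (one_div_pos.2 (hmin x)).le)
    (fun x _ => mul_nonneg (sq_nonneg _) (hmin x).le)
    (fun x _ => by
      have := (hmin x).ne'
      rw [sq_abs]; field_simp; rfl)
  have hinv : ∑ x ∈ J, 1 / min (f x) (f (x + 1)) ≤ 2 * ∑ x ∈ Icc m n, 1 / f x := by
    have hle : ∀ x, 1 / min (f x) (f (x + 1)) ≤ 1 / f x + 1 / f (x + 1) := by
      intro x
      have h1 := one_div_pos.2 (hf x)
      have h2 := one_div_pos.2 (hf (x + 1))
      rcases min_choice (f x) (f (x + 1)) with h | h <;> rw [h] <;> linarith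
    have hshift : ∑ x ∈ J, 1 / f (x + 1) ≤ ∑ x ∈ Icc m n, 1 / f x := by
      rw [← sum_image (s := J) (g := fun x => x + 1) (f := fun x => 1 / f x)
        (fun x _ y _ h => by simpa using h)]
      refine sum_le_sum_of_subset_of_nonneg ?_ fun x _ _ => (one_div_pos.2 (hf x)).le
      intro y hy
      obtain ⟨x, hx, rfl⟩ := mem_image.1 hy
      exact (mem_filter.1 hx).2
    have hid : ∑ x ∈ J, 1 / f x ≤ ∑ x ∈ Icc m n, 1 / f x :=
      sum_le_sum_of_subset_of_nonneg (filter_subset _ _) fun x _ _ => (one_div_pos.2 (hf x)).le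
    have := sum_le_sum fun x (_ : x ∈ J) => hle x
    rw [sum_add_distrib] at this
    linarith
  have hJsum : ∑ x ∈ J, (v (x + 1) - v x) ^ 2 * min (f x) (f (x + 1)) =
      ∑ x ∈ Icc m n, if x + 1 ∈ Icc m n then
        (v (x + 1) - v x) ^ 2 * min (f x) (f (x + 1)) else 0 := by
    rw [hJ, sum_filter]
  rw [← hJsum, ← sq_abs]
  calc |v i - v j| ^ 2 ≤ (∑ x ∈ J, |v (x + 1) - v x|) ^ 2 := by gcongr
    _ ≤ _ := hcs
    _ ≤ _ := by
      gcongr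
      exact sum_nonneg fun x _ => mul_nonneg (sq_nonneg _) (hmin x).le

/-- The total weighted energy of `u` on the edges of the square `{m,…,n}²`. -/
lemma sum_edges_eq_metroDirichlet2 (F : ℤ × ℤ → ℝ) (hF : ∀ k, 0 < F k) (u : ℤ × ℤ → ℝ)
    (m n : ℤ) (hmn : m ≤ n) :
    (∑ y ∈ Icc m n, ∑ x ∈ Icc m n, if x + 1 ∈ Icc m n then
        (u (x + 1, y) - u (x, y)) ^ 2 * min (F (x, y)) (F (x + 1, y)) else 0) +
      (∑ x ∈ Icc m n, ∑ y ∈ Icc m n, if y + 1 ∈ Icc m n then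
        (u (x, y + 1) - u (x, y)) ^ 2 * min (F (x, y)) (F (x, y + 1)) else 0) =
    4 * (∑ k ∈ Icc m n ×ˢ Icc m n, F k) * metroDirichlet2 (Icc m n ×ˢ Icc m n) F u := by
  have hZ : 0 < ∑ k ∈ Icc m n ×ˢ Icc m n, F k :=
    sum_pos (fun k _ => hF k) ⟨(m, m), by simp [hmn]⟩
  unfold metroDirichlet2 metroPi2
  generalize ∑ k ∈ Icc m n ×ˢ Icc m n, F k = Z at *
  rw [mul_add, mul_sum, mul_sum]
  congr 1
  · rw [sum_product_right]
    refine sum_congr rfl fun y hy => sum_congr rfl fun x hx => ?_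
    simp only [mem_product, hy, and_true]
    split_ifs
    · rw [min_div_div_right hZ.le]
      field_simp
    · simp
  · rw [sum_product]
    refine sum_congr rfl fun x hx => sum_congr rfl fun y hy => ?_
    simp only [mem_product, hx, true_and]
    split_ifs
    · rw [min_div_div_right hZ.le]
      field_simp
    · simp

/-- Poincaré inequality on a square from paths with a single turn. -/
lemma sum_sum_sq_sub_le_metroDirichlet2 (F : ℤ × ℤ → ℝ) (hF : ∀ k, 0 < F k)
    (u : ℤ × ℤ → ℝ) (m n : ℤ) (hmn : m ≤ n) (M M' : ℝ)
    (hM : ∀ k ∈ Icc m n ×ˢ Icc m n, F k ≤ M)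
    (hrow : ∀ k ∈ Icc m n ×ˢ Icc m n, F k * ∑ x ∈ Icc m n, 1 / F (x, k.2) ≤ M')
    (hcol : ∀ k ∈ Icc m n ×ˢ Icc m n, F k * ∑ y ∈ Icc m n, 1 / F (k.1, y) ≤ M') :
    ∑ k ∈ Icc m n ×ˢ Icc m n, ∑ l ∈ Icc m n ×ˢ Icc m n, F k * F l * (u k - u l) ^ 2 ≤
      16 * M * M' * ((n : ℝ) + 1 - m) ^ 3 * (∑ k ∈ Icc m n ×ˢ Icc m n, F k) *
        metroDirichlet2 (Icc m n ×ˢ Icc m n) F u := by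
  set H : ℤ → ℝ := fun y => ∑ x ∈ Icc m n, if x + 1 ∈ Icc m n then
        (u (x + 1, y) - u (x, y)) ^ 2 * min (F (x, y)) (F (x + 1, y)) else 0 with hH
  set V : ℤ → ℝ := fun x => ∑ y ∈ Icc m n, if y + 1 ∈ Icc m n then
        (u (x, y + 1) - u (x, y)) ^ 2 * min (F (x, y)) (F (x, y + 1)) else 0 with hV
  have hE := sum_edges_eq_metroDirichlet2 F hF u m n hmn
  have hH0 : ∀ y, 0 ≤ H y := fun y => sum_nonneg fun x _ => by
    split_ifs
    · exact mul_nonneg (sq_nonneg _) (le_min (hF _).le (hF _).le)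
    · exact le_rfl
  have hV0 : ∀ y, 0 ≤ V y := fun y => sum_nonneg fun x _ => by
    split_ifs
    · exact mul_nonneg (sq_nonneg _) (le_min (hF _).le (hF _).le)
    · exact le_rfl
  have hmm : (m, m) ∈ Icc m n ×ˢ Icc m n := by simp [hmn]
  have hM0 : 0 ≤ M := (hF (m, m)).le.trans (hM _ hmm)
  have key : ∀ k ∈ Icc m n ×ˢ Icc m n, ∀ l ∈ Icc m n ×ˢ Icc m n,
      F k * F l * (u k - u l) ^ 2 ≤ 4 * M * M' * (H k.2 + V l.1) := by
    rintro ⟨k1, k2⟩ hk ⟨l1, l2⟩ hl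
    have hk' := mem_product.1 hk
    have hl' := mem_product.1 hl
    have h1 := sq_sub_le_sum_inv_mul_sum_min (fun x => F (x, k2)) (fun x => u (x, k2))
      (fun x => hF _) m n hk'.1 hl'.1
    have h2 := sq_sub_le_sum_inv_mul_sum_min (fun y => F (l1, y)) (fun y => u (l1, y))
      (fun x => hF _) m n hk'.2 hl'.2
    have r := hrow _ hk
    have c := hcol _ hl
    change _ ≤ _ * H k2 at h1
    change _ ≤ _ * V l1 at h2
    dsimp only at h1 h2 r c ⊢
    set G := ∑ x ∈ Icc m n, 1 / F (x, k2)
    set G' := ∑ y ∈ Icc m n, 1 / F (l1, y)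
    have hFk := hF (k1, k2)
    have hFl := hF (l1, l2)
    have hsq : (u (k1, k2) - u (l1, l2)) ^ 2 ≤
        2 * (2 * G * H k2) + 2 * (2 * G' * V l1) := by
      nlinarith [sq_nonneg ((u (k1, k2) - u (l1, k2)) - (u (l1, k2) - u (l1, l2)))]
    have hG : 0 ≤ G := sum_nonneg fun x _ => (one_div_pos.2 (hF _)).le
    have hG' : 0 ≤ G' := sum_nonneg fun x _ => (one_div_pos.2 (hF _)).le
    have e1 : F (l1, l2) * (F (k1, k2) * G) * H k2 ≤ M * M' * H k2 :=
      mul_le_mul_of_nonneg_right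
        (mul_le_mul (hM _ hl) r (mul_nonneg hFk.le hG) hM0) (hH0 _)
    have e2 : F (k1, k2) * (F (l1, l2) * G') * V l1 ≤ M * M' * V l1 :=
      mul_le_mul_of_nonneg_right
        (mul_le_mul (hM _ hk) c (mul_nonneg hFl.le hG') hM0) (hV0 _)
    calc _ ≤ F (k1, k2) * F (l1, l2) * (2 * (2 * G * H k2) + 2 * (2 * G' * V l1)) := by gcongr
      _ = 4 * (F (l1, l2) * (F (k1, k2) * G) * H k2) +
          4 * (F (k1, k2) * (F (l1, l2) * G') * V l1) := by ring
      _ ≤ _ := by linarith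
  have hcard : ((Icc m n).card : ℝ) = (n : ℝ) + 1 - m := by
    have : (((n + 1 - m).toNat : ℤ) : ℝ) = ((n + 1 - m : ℤ) : ℝ) := by
      congr 1; omega
    rw [Int.card_Icc]
    push_cast at this
    exact this
  calc _ ≤ ∑ k ∈ Icc m n ×ˢ Icc m n, ∑ l ∈ Icc m n ×ˢ Icc m n,
        4 * M * M' * (H k.2 + V l.1) :=
        sum_le_sum fun k hk => sum_le_sum fun l hl => key k hk l hl
    _ = 4 * M * M' * ((n : ℝ) + 1 - m) ^ 3 * (∑ y ∈ Icc m n, H y + ∑ x ∈ Icc m n, V x) := by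
        simp only [← mul_sum, sum_add_distrib, sum_product, sum_const, card_product,
          nsmul_eq_mul, Nat.cast_mul, hcard]
        ring
    _ = _ := by
        rw [hE]; ring

lemma two_mul_metroVar2_mul_sq (box : Finset (ℤ × ℤ)) (F u : ℤ × ℤ → ℝ)
    (hZ : ∑ k ∈ box, F k ≠ 0) :
    2 * metroVar2 box F u * (∑ k ∈ box, F k) ^ 2 =
      ∑ k ∈ box, ∑ l ∈ box, F k * F l * (u k - u l) ^ 2 := by
  unfold metroVar2 metroPi2
  set Z := ∑ k ∈ box, F k with hZd
  set S1 := ∑ k ∈ box, u k * F k with hS1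
  set S2 := ∑ k ∈ box, u k ^ 2 * F k with hS2
  have hm : ∑ l ∈ box, u l * (F l / Z) = S1 / Z := by
    rw [hS1, sum_div]
    exact sum_congr rfl fun _ _ => by ring
  have hR : ∑ k ∈ box, ∑ l ∈ box, F k * F l * (u k - u l) ^ 2 = 2 * (S2 * Z - S1 ^ 2) := by
    have : ∀ k l, F k * F l * (u k - u l) ^ 2 =
        (u k ^ 2 * F k) * F l + F k * (u l ^ 2 * F l) - 2 * ((u k * F k) * (u l * F l)) := by
      intros; ring
    simp only [this, sum_sub_distrib, sum_add_distrib, ← mul_sum, ← sum_mul]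
    rw [← hS1, ← hS2, ← hZd]
    ring
  have hL : ∀ c : ℝ, ∑ k ∈ box, (u k - c) ^ 2 * (F k / Z) =
      (S2 - 2 * c * S1 + c ^ 2 * Z) / Z := by
    intro c
    have : ∀ k, (u k - c) ^ 2 * (F k / Z) =
        (u k ^ 2 * F k - 2 * c * (u k * F k) + c ^ 2 * F k) / Z := by
      intros; ring
    simp only [this, ← sum_div, sum_add_distrib, sum_sub_distrib, ← mul_sum]
    rw [← hS1, ← hS2, ← hZd]
  rw [hm, hR, hL]
  field_simp
  ring

lemma metroVar2_nonneg (box : Finset (ℤ × ℤ)) (F u : ℤ × ℤ → ℝ) (hF : ∀ k, 0 < F k) :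
    0 ≤ metroVar2 box F u :=
  sum_nonneg fun k _ => mul_nonneg (sq_nonneg _)
    (div_nonneg (hF k).le (sum_nonneg fun l _ => (hF l).le))

lemma metroDirichlet2_nonneg (box : Finset (ℤ × ℤ)) (F u : ℤ × ℤ → ℝ) (hF : ∀ k, 0 < F k) :
    0 ≤ metroDirichlet2 box F u := by
  have hπ : ∀ k, 0 ≤ metroPi2 box F k := fun k =>
    div_nonneg (hF k).le (sum_nonneg fun l _ => (hF l).le)
  refine add_nonneg (sum_nonneg fun k _ => ?_) (sum_nonneg fun k _ => ?_) <;>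
  · split_ifs
    · exact mul_nonneg (sq_nonneg _) (mul_nonneg (by norm_num) (le_min (hπ _) (hπ _)))
    · exact le_rfl

/-- Uniform bound on the sums of `(1 + |p x + t|)^(-α)` over integers, with the right order in
the slope `p`. -/
lemma exists_rpow_mul_sum_inv_rpow_le (α : ℝ) (hα : 1 < α) (R : ℝ) (hR : 1 ≤ R) :
    ∃ C : ℝ, 0 < C ∧ ∀ (p t : ℝ) (I : Finset ℤ), |p| ≤ R →
      |p| ^ α * ∑ x ∈ I, 1 / (1 + |p * ((x : ℝ) - 1 / 2) + t|) ^ α ≤ C := by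
  have hα0 : 0 < α := by linarith
  have hs : Summable fun n : ℤ => 1 / (1 + |(n : ℝ)|) ^ α := by
    have h := (Real.summable_one_div_int_add_rpow (1 / 2) α).2 hα
    refine h.of_nonneg_of_le (fun n => by positivity) fun n => ?_
    have hn : 0 < |(n : ℝ) + 1 / 2| := by
      rw [abs_pos]
      intro h
      have : ((2 * n + 1 : ℤ) : ℝ) = 0 := by push_cast; linarith
      have := Int.cast_eq_zero.1 this
      omega
    apply one_div_le_one_div_of_le (Real.rpow_pos_of_pos hn α)
    apply Real.rpow_le_rpow hn.le _ hα0.le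
    have := abs_add_le (n : ℝ) (1 / 2)
    rw [abs_of_pos (by norm_num : (0 : ℝ) < 1 / 2)] at this
    linarith
  set T := ∑' n : ℤ, 1 / (1 + |(n : ℝ)|) ^ α
  have hT : 0 ≤ T := tsum_nonneg fun n => by positivity
  refine ⟨(2 * R) ^ α * T + 1, by positivity, fun p t I hp => ?_⟩
  rcases eq_or_ne p 0 with rfl | hp0
  · rw [abs_zero, Real.zero_rpow hα0.ne', zero_mul]
    positivity
  have hp' : 0 < |p| := abs_pos.2 hp0
  set τ := t / p - 1 / 2 with hτ
  have hterm : ∀ x : ℤ, |p| ^ α * (1 / (1 + |p * ((x : ℝ) - 1 / 2) + t|) ^ α) ≤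
      (2 * R) ^ α * (1 / (1 + |((x + ⌊τ⌋ : ℤ) : ℝ)|) ^ α) := by
    intro x
    rw [mul_one_div, mul_one_div, ← Real.div_rpow (by positivity) (by positivity),
      ← Real.div_rpow (by positivity) (by positivity)]
    apply Real.rpow_le_rpow (by positivity) _ hα0.le
    rw [div_le_div_iff₀ (by positivity) (by positivity)]
    have e : p * ((x : ℝ) - 1 / 2) + t = p * (x + τ) := by
      rw [hτ]; field_simp; ring
    have h1 : |((x + ⌊τ⌋ : ℤ) : ℝ)| ≤ |(x : ℝ) + τ| + 1 := by
      have : ((x + ⌊τ⌋ : ℤ) : ℝ) = (x + τ) - Int.fract τ := by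
        push_cast; rw [← Int.self_sub_floor]; ring
      rw [this]
      refine (abs_sub _ _).trans ?_
      rw [abs_of_nonneg (Int.fract_nonneg τ)]
      linarith [Int.fract_lt_one τ]
    rw [e, abs_mul]
    have h2 := abs_nonneg ((x : ℝ) + τ)
    nlinarith [mul_nonneg hp'.le h2, mul_le_mul_of_nonneg_left h1 hp'.le,
      mul_nonneg (mul_nonneg hp'.le h2) (sub_nonneg.2 hR)]
  rw [mul_sum]
  calc _ ≤ ∑ x ∈ I, (2 * R) ^ α * (1 / (1 + |((x + ⌊τ⌋ : ℤ) : ℝ)|) ^ α) :=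
        sum_le_sum fun x _ => hterm x
    _ = (2 * R) ^ α * ∑ x ∈ I.map (addRightEmbedding ⌊τ⌋), 1 / (1 + |(x : ℝ)|) ^ α := by
        rw [← mul_sum, sum_map]; rfl
    _ ≤ (2 * R) ^ α * T := by
        gcongr
        exact hs.sum_le_tsum _ fun n _ => by positivity
    _ ≤ _ := by linarith

lemma add_rpow_le_two_rpow_mul {x y α : ℝ} (hx : 0 ≤ x) (hy : 0 ≤ y) (hα : 0 ≤ α) :
    (x + y) ^ α ≤ 2 ^ α * (x ^ α + y ^ α) := by
  have hx' := Real.rpow_nonneg hx α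
  have hy' := Real.rpow_nonneg hy α
  calc (x + y) ^ α ≤ (2 * max x y) ^ α :=
        Real.rpow_le_rpow (by positivity)
          (by linarith [le_max_left x y, le_max_right x y]) hα
    _ = 2 ^ α * (max x y) ^ α := Real.mul_rpow (by norm_num) (le_max_of_le_left hx)
    _ ≤ _ := by
        gcongr
        rcases max_choice x y with h | h <;> rw [h] <;> linarith

lemma card_Icc_centred {N : ℤ} (hN : 1 ≤ N) : ((Icc (-N + 1) N).card : ℝ) = 2 * N := by
  have : (((N + 1 - (-N + 1)).toNat : ℤ) : ℝ) = ((2 * N : ℤ) : ℝ) := by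
    congr 1; omega
  rw [Int.card_Icc]
  push_cast at this
  exact this

lemma abs_sub_half_le {N x : ℤ} (hx : x ∈ Icc (-N + 1) N) : |(x : ℝ) - 1 / 2| ≤ N := by
  obtain ⟨h1, h2⟩ := mem_Icc.1 hx
  have h1' : (-N + 1 : ℝ) ≤ x := by exact_mod_cast h1
  have h2' : (x : ℝ) ≤ N := by exact_mod_cast h2
  rw [abs_le]; constructor <;> linarith

lemma self_le_rpow_of_one_le {x α : ℝ} (hx : 1 ≤ x) (hα : 1 ≤ α) : x ≤ x ^ α := by
  simpa using Real.rpow_le_rpow_of_exponent_le hx hα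

/-- A weighted row sum of inverses, uniformly in the slope of the restricted affine form. -/
lemma exists_rpow_mul_sum_inv_le_rpow (α : ℝ) (hα : 1 < α) (R : ℝ) (hR : 1 ≤ R) :
    ∃ C : ℝ, 0 < C ∧ ∀ (p t : ℝ) (N z : ℤ), |p| ≤ R → 1 ≤ N → z ∈ Icc (-N + 1) N →
      (1 + |p * ((z : ℝ) - 1 / 2) + t|) ^ α *
        ∑ x ∈ Icc (-N + 1) N, 1 / (1 + |p * ((x : ℝ) - 1 / 2) + t|) ^ α ≤ C * (N : ℝ) ^ α := by
  obtain ⟨C, hC, hsum⟩ := exists_rpow_mul_sum_inv_rpow_le α hα R hR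
  have hα0 : 0 < α := by linarith
  refine ⟨2 ^ α * (2 + 2 ^ α * C), by positivity, fun p t N z hp hN hz => ?_⟩
  have hN' : (1 : ℝ) ≤ N := by exact_mod_cast hN
  have hterm : ∀ x ∈ Icc (-N + 1) N, (1 + |p * ((z : ℝ) - 1 / 2) + t|) ^ α *
      (1 / (1 + |p * ((x : ℝ) - 1 / 2) + t|) ^ α) ≤
      2 ^ α * (1 + (2 * N) ^ α * (|p| ^ α * (1 / (1 + |p * ((x : ℝ) - 1 / 2) + t|) ^ α))) := by
    intro x hx
    set w := 1 + |p * ((x : ℝ) - 1 / 2) + t| with hw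
    have hw0 : 0 < w := by positivity
    have hle : 1 + |p * ((z : ℝ) - 1 / 2) + t| ≤ w + 2 * N * |p| := by
      have e : p * ((z : ℝ) - 1 / 2) + t = (p * ((x : ℝ) - 1 / 2) + t) +
        p * (((z : ℝ) - 1 / 2) - ((x : ℝ) - 1 / 2)) := by ring
      have h1 := abs_add_le (p * ((x : ℝ) - 1 / 2) + t)
        (p * (((z : ℝ) - 1 / 2) - ((x : ℝ) - 1 / 2)))
      have h2 := abs_sub ((z : ℝ) - 1 / 2) ((x : ℝ) - 1 / 2)
      have h3 := abs_sub_half_le hx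
      have h4 := abs_sub_half_le hz
      rw [← e, abs_mul] at h1
      nlinarith [abs_nonneg p]
    have h5 : (1 + |p * ((z : ℝ) - 1 / 2) + t|) ^ α ≤
        2 ^ α * (w ^ α + (2 * N) ^ α * |p| ^ α) := by
      rw [← Real.mul_rpow (by positivity) (by positivity)]
      exact (Real.rpow_le_rpow (by positivity) hle hα0.le).trans
        (add_rpow_le_two_rpow_mul hw0.le (by positivity) hα0.le)
    have hwα : 0 < w ^ α := Real.rpow_pos_of_pos hw0 α
    calc _ ≤ 2 ^ α * (w ^ α + (2 * N) ^ α * |p| ^ α) * (1 / w ^ α) := by gcongr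
      _ = _ := by field_simp
  rw [mul_sum]
  refine (sum_le_sum hterm).trans ?_
  rw [← mul_sum, sum_add_distrib, sum_const, ← mul_sum, ← mul_sum, nsmul_eq_mul,
    card_Icc_centred hN, mul_assoc (2 ^ α)]
  gcongr
  have h1 := hsum p t (Icc (-N + 1) N) hp
  have h2 := self_le_rpow_of_one_le hN' hα.le
  rw [Real.mul_rpow (by norm_num) (by linarith)]
  have h3 : (0 : ℝ) ≤ 2 ^ α * (N : ℝ) ^ α := by positivity
  nlinarith [mul_le_mul_of_nonneg_left h1 h3]

lemma sum_sub_half_Icc (N : ℤ) :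
    ∑ x ∈ Icc (-N + 1) N, ((x : ℝ) - 1 / 2) = 0 := by
  refine sum_involution (fun x _ => 1 - x) (fun x _ => by push_cast; ring)
    (fun x _ _ => by omega) (fun x hx => ?_) (fun x _ => by simp)
  simp only [mem_Icc] at *
  omega

lemma sum_sub_half_sq_Icc {N : ℤ} (hN : 1 ≤ N) :
    ∑ x ∈ Icc (-N + 1) N, ((x : ℝ) - 1 / 2) ^ 2 = N * (4 * (N : ℝ) ^ 2 - 1) / 6 := by
  have : ∀ n : ℕ, ∑ x ∈ Icc (-(n : ℤ) + 1) n, ((x : ℝ) - 1 / 2) ^ 2 =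
      n * (4 * (n : ℝ) ^ 2 - 1) / 6 := by
    intro n
    induction n with
    | zero => simp
    | succ n ih =>
      have : Icc (-((n + 1 : ℕ) : ℤ) + 1) ((n + 1 : ℕ) : ℤ) =
          insert (-(n : ℤ)) (insert ((n : ℤ) + 1) (Icc (-(n : ℤ) + 1) n)) := by
        ext x; simp only [mem_Icc, mem_insert]; omega
      rw [this, sum_insert (by simp only [mem_Icc, mem_insert]; omega),
        sum_insert (by simp only [mem_Icc]; omega), ih]
      push_cast
      ring
  lift N to ℕ using by omega
  exact_mod_cast this N

lemma sum_centredForm_sq {N : ℤ} (hN : 1 ≤ N) (p q : ℝ) :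
    ∑ k ∈ Icc (-N + 1) N ×ˢ Icc (-N + 1) N, centredForm p q k ^ 2 =
      (p ^ 2 + q ^ 2) * ((N : ℝ) ^ 2 * (4 * (N : ℝ) ^ 2 - 1) / 3) := by
  have : ∀ x y : ℤ, centredForm p q (x, y) ^ 2 = p ^ 2 * ((x : ℝ) - 1 / 2) ^ 2 +
      2 * p * q * (((x : ℝ) - 1 / 2) * ((y : ℝ) - 1 / 2)) + q ^ 2 * ((y : ℝ) - 1 / 2) ^ 2 := by
    intros; unfold centredForm; ring
  simp only [sum_product, this, sum_add_distrib, ← mul_sum, ← sum_mul, sum_const, nsmul_eq_mul,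
    card_Icc_centred hN, sum_sub_half_Icc N, sum_sub_half_sq_Icc hN]
  ring

lemma abs_centredForm_le {N : ℤ} {p q R : ℝ} (hp : |p| ≤ R) (hq : |q| ≤ R)
    {k : ℤ × ℤ} (hk : k ∈ Icc (-N + 1) N ×ˢ Icc (-N + 1) N) :
    |centredForm p q k| ≤ 2 * R * N := by
  obtain ⟨h1, h2⟩ := mem_product.1 hk
  have h1 := abs_sub_half_le h1
  have h2 := abs_sub_half_le h2
  have hR : 0 ≤ R := (abs_nonneg p).trans hp
  unfold centredForm
  have := abs_add_le (p * ((k.1 : ℝ) - 1 / 2)) (q * ((k.2 : ℝ) - 1 / 2))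
  rw [abs_mul, abs_mul] at this
  have := mul_le_mul hp h1 (abs_nonneg _) hR
  have := mul_le_mul hq h2 (abs_nonneg _) hR
  linarith

/-- Most of the mass of the square lies far from the line. -/
lemma le_sum_abs_centredForm_rpow {α : ℝ} (hα : 0 < α) {R : ℝ} (hR : 1 ≤ R) {N : ℤ} (hN : 1 ≤ N)
    {p q : ℝ} (hp : |p| ≤ R) (hq : |q| ≤ R) (hpq : 1 / R ^ 2 ≤ p ^ 2 + q ^ 2) :
    (1 / (4 * R)) ^ α * (1 / (8 * R ^ 4)) * (N : ℝ) ^ (α + 2) ≤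
      ∑ k ∈ Icc (-N + 1) N ×ˢ Icc (-N + 1) N, |centredForm p q k| ^ α := by
  have hN' : (1 : ℝ) ≤ N := by exact_mod_cast hN
  have hR0 : 0 < R := by linarith
  have hN0 : (0 : ℝ) < N := by linarith
  set d := N / (4 * R) with hd
  have hd0 : 0 < d := by positivity
  have hterm : ∀ k ∈ Icc (-N + 1) N ×ˢ Icc (-N + 1) N,
      d ^ α * ((centredForm p q k ^ 2 - d ^ 2) / (4 * R ^ 2 * N ^ 2)) ≤
        |centredForm p q k| ^ α := by
    intro k hk
    have hS := abs_centredForm_le hp hq hk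
    rw [← sq_abs (centredForm p q k)]
    set s := |centredForm p q k|
    have hs : 0 ≤ s := abs_nonneg _
    have hdα : 0 < d ^ α := Real.rpow_pos_of_pos hd0 α
    rcases le_total s d with h | h
    · have h1 : (s ^ 2 - d ^ 2) / (4 * R ^ 2 * N ^ 2) ≤ 0 :=
        div_nonpos_of_nonpos_of_nonneg (by nlinarith) (by positivity)
      exact (mul_nonpos_of_nonneg_of_nonpos hdα.le h1).trans (Real.rpow_nonneg hs α)
    · have h1 : (s ^ 2 - d ^ 2) / (4 * R ^ 2 * N ^ 2) ≤ 1 := by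
        rw [div_le_one (by positivity)]
        nlinarith [sq_nonneg d]
      calc _ ≤ d ^ α * 1 := by gcongr
        _ ≤ _ := by rw [mul_one]; exact Real.rpow_le_rpow hd0.le h hα.le
  refine le_trans ?_ (sum_le_sum hterm)
  rw [← mul_sum, ← sum_div, sum_sub_distrib, sum_centredForm_sq hN, sum_const, card_product,
    nsmul_eq_mul, Nat.cast_mul, card_Icc_centred hN]
  have e : d = (1 / (4 * R)) * N := by rw [hd]; ring
  have e2 : (N : ℝ) ^ (α + 2) = (N : ℝ) ^ α * (N : ℝ) ^ 2 := by
    rw [Real.rpow_add hN0]; norm_num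
  have e3 : d ^ α = (1 / (4 * R)) ^ α * (N : ℝ) ^ α := by
    rw [e, Real.mul_rpow (by positivity) hN0.le]
  have h1 : (N : ℝ) ^ 2 / (8 * R ^ 4) ≤
      ((p ^ 2 + q ^ 2) * ((N : ℝ) ^ 2 * (4 * (N : ℝ) ^ 2 - 1) / 3) - 2 * N * (2 * N) * d ^ 2) /
        (4 * R ^ 2 * N ^ 2) := by
    have hN2 : (N : ℝ) ^ 2 ≤ (4 * (N : ℝ) ^ 2 - 1) / 3 := by nlinarith
    have h2 : 1 / R ^ 2 * (N : ℝ) ^ 4 ≤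
        (p ^ 2 + q ^ 2) * ((N : ℝ) ^ 2 * (4 * (N : ℝ) ^ 2 - 1) / 3) := by
      apply mul_le_mul hpq _ (by positivity) (by positivity)
      nlinarith [sq_nonneg (N : ℝ)]
    rw [le_div_iff₀ (by positivity)]
    have h3 : (N : ℝ) ^ 2 / (8 * R ^ 4) * (4 * R ^ 2 * N ^ 2) = 1 / 2 * (1 / R ^ 2 * (N : ℝ) ^ 4) := by
      field_simp; ring
    have h4 : 2 * N * (2 * N) * d ^ 2 = 1 / 4 * (1 / R ^ 2 * (N : ℝ) ^ 4) := by
      rw [hd]; field_simp; ring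
    have h5 : 0 ≤ 1 / R ^ 2 * (N : ℝ) ^ 4 := by positivity
    rw [h3, h4]
    linarith
  calc _ = (1 / (4 * R)) ^ α * (N : ℝ) ^ α * ((N : ℝ) ^ 2 / (8 * R ^ 4)) := by rw [e2]; ring
    _ ≤ _ := by rw [e3]; gcongr

lemma one_add_abs_centredForm_rpow_pos (α p q : ℝ) (k : ℤ × ℤ) :
    0 < (1 + |centredForm p q k|) ^ α := by positivity

/-- The spectral gap is at least of order `N ^ (-(α + 1))`. -/
lemma exists_div_rpow_mul_metroVar2_le (α : ℝ) (hα : 1 < α) (R : ℝ) (hR : 1 ≤ R) :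
    ∃ c : ℝ, 0 < c ∧ ∀ (p q : ℝ) (N : ℤ), |p| ≤ R → |q| ≤ R → 1 / R ^ 2 ≤ p ^ 2 + q ^ 2 →
      1 ≤ N → ∀ u : ℤ × ℤ → ℝ,
      c / (N : ℝ) ^ (α + 1) *
        metroVar2 (Icc (-N + 1) N ×ˢ Icc (-N + 1) N) (fun k => (1 + |centredForm p q k|) ^ α) u ≤
      metroDirichlet2 (Icc (-N + 1) N ×ˢ Icc (-N + 1) N)
        (fun k => (1 + |centredForm p q k|) ^ α) u := by
  obtain ⟨C, hC, hrow⟩ := exists_rpow_mul_sum_inv_le_rpow α hα R hR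
  have hα0 : 0 < α := by linarith
  have hR0 : 0 < R := by linarith
  set c0 := (1 / (4 * R)) ^ α * (1 / (8 * R ^ 4)) with hc0
  have hc0' : 0 < c0 := by positivity
  refine ⟨c0 / (64 * (3 * R) ^ α * C), by positivity, fun p q N hp hq hpq hN u => ?_⟩
  have hN' : (1 : ℝ) ≤ N := by exact_mod_cast hN
  have hN0 : (0 : ℝ) < N := by linarith
  set F : ℤ × ℤ → ℝ := fun k => (1 + |centredForm p q k|) ^ α with hFd
  have hF : ∀ k, 0 < F k := one_add_abs_centredForm_rpow_pos α p q
  set box := Icc (-N + 1) N ×ˢ Icc (-N + 1) N with hbox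
  have hZle : c0 * (N : ℝ) ^ (α + 2) ≤ ∑ k ∈ box, F k :=
    (le_sum_abs_centredForm_rpow hα0 hR hN hp hq hpq).trans
      (sum_le_sum fun k _ => Real.rpow_le_rpow (abs_nonneg _) (by linarith) hα0.le)
  have hZ : 0 < ∑ k ∈ box, F k := lt_of_lt_of_le (by positivity) hZle
  have hM : ∀ k ∈ box, F k ≤ (3 * R) ^ α * (N : ℝ) ^ α := by
    intro k hk
    rw [← Real.mul_rpow (by positivity) hN0.le]
    apply Real.rpow_le_rpow (by positivity) _ hα0.le
    have := abs_centredForm_le hp hq hk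
    nlinarith
  have h1 := sum_sum_sq_sub_le_metroDirichlet2 F hF u (-N + 1) N (by omega) _ (C * (N : ℝ) ^ α) hM
    (fun k hk => hrow p (q * ((k.2 : ℝ) - 1 / 2)) N k.1 hp hN (mem_product.1 hk).1)
    (fun k hk => by
      have := hrow q (p * ((k.1 : ℝ) - 1 / 2)) N k.2 hq hN (mem_product.1 hk).2
      simp only [add_comm _ (p * ((k.1 : ℝ) - 1 / 2))] at this
      exact this)
  rw [← two_mul_metroVar2_mul_sq _ F u hZ.ne'] at h1
  have hV := metroVar2_nonneg box F u hF
  set Z := ∑ k ∈ box, F k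
  set V := metroVar2 box F u
  set D := metroDirichlet2 box F u
  have h2 : V * Z ≤ 64 * (3 * R) ^ α * C * ((N : ℝ) ^ α * (N : ℝ) ^ α * (N : ℝ) ^ 3) * D := by
    refine le_of_mul_le_mul_right ?_ hZ
    push_cast at h1
    nlinarith
  have h3 : V * (c0 * (N : ℝ) ^ (α + 2)) ≤ V * Z := by gcongr
  have e2 : (N : ℝ) ^ (α + 2) = (N : ℝ) ^ α * (N : ℝ) ^ 2 := by
    rw [Real.rpow_add hN0]; norm_num
  have e1 : (N : ℝ) ^ (α + 1) = (N : ℝ) ^ α * N := Real.rpow_add_one hN0.ne' α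
  rw [e2] at h3
  have hn : 0 < (N : ℝ) ^ α := by positivity
  have h3R : 0 < (3 * R) ^ α := by positivity
  rw [e1, div_div, div_mul_eq_mul_div, div_le_iff₀ (by positivity)]
  refine le_of_mul_le_mul_right ?_ (by positivity : 0 < (N : ℝ) ^ α * (N : ℝ) ^ 2)
  linarith

lemma sq_sign_sub_mul_rpow_le {α : ℝ} (hα : 0 ≤ α) {R s r : ℝ} (hr : |r| ≤ R) :
    (Real.sign (s + r) - Real.sign s) ^ 2 * (1 + |s|) ^ α ≤
      4 * (1 + R) ^ (2 * α) * (1 / (1 + |s|) ^ α) := by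
  have hR : 0 ≤ R := (abs_nonneg r).trans hr
  have hs : 0 < (1 + |s|) ^ α := by positivity
  by_cases h : |s| ≤ R
  · have h1 : (Real.sign (s + r) - Real.sign s) ^ 2 ≤ 4 := by
      rcases Real.sign_apply_eq (s + r) with h | h | h <;>
      rcases Real.sign_apply_eq s with h' | h' | h' <;> rw [h, h'] <;> norm_num
    have h2 : (1 + |s|) ^ α ≤ (1 + R) ^ α := Real.rpow_le_rpow (by positivity) (by linarith) hα
    rw [mul_one_div, le_div_iff₀ hs, two_mul α, Real.rpow_add (by positivity)]
    calc _ = (Real.sign (s + r) - Real.sign s) ^ 2 * ((1 + |s|) ^ α * (1 + |s|) ^ α) := by ring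
      _ ≤ _ := by gcongr
  · have h0 : Real.sign (s + r) = Real.sign s := by
      have := abs_le.1 hr
      rcases lt_abs.1 (not_le.1 h) with h' | h'
      · rw [Real.sign_of_pos (by linarith), Real.sign_of_pos (by linarith)]
      · rw [Real.sign_of_neg (by linarith), Real.sign_of_neg (by linarith)]
    rw [h0, sub_self]
    have : 0 ≤ 4 * (1 + R) ^ (2 * α) * (1 / (1 + |s|) ^ α) := by positivity
    simpa using this

/-- Few points of the square lie close to the line. -/
lemma exists_sum_inv_rpow_le (α : ℝ) (hα : 1 < α) (R : ℝ) (hR : 1 ≤ R) :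
    ∃ C : ℝ, 0 < C ∧ ∀ (p q : ℝ) (N : ℤ), |p| ≤ R → |q| ≤ R → 1 / R ^ 2 ≤ p ^ 2 + q ^ 2 →
      1 ≤ N → ∑ k ∈ Icc (-N + 1) N ×ˢ Icc (-N + 1) N, 1 / (1 + |centredForm p q k|) ^ α ≤
        C * N := by
  obtain ⟨C, hC, hsum⟩ := exists_rpow_mul_sum_inv_rpow_le α hα R hR
  have hR0 : 0 < R := by linarith
  refine ⟨2 * ((2 * R) ^ α * C), by positivity, fun p q N hp hq hpq hN => ?_⟩
  have hline : ∀ p t : ℝ, |p| ≤ R → 1 / (2 * R) ≤ |p| →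
      ∑ x ∈ Icc (-N + 1) N, 1 / (1 + |p * ((x : ℝ) - 1 / 2) + t|) ^ α ≤ (2 * R) ^ α * C := by
    intro p t hp hp'
    have h1 := hsum p t (Icc (-N + 1) N) hp
    set T := ∑ x ∈ Icc (-N + 1) N, 1 / (1 + |p * ((x : ℝ) - 1 / 2) + t|) ^ α
    have hT : 0 ≤ T := sum_nonneg fun x _ => by positivity
    have h2 : (1 / (2 * R)) ^ α ≤ |p| ^ α :=
      Real.rpow_le_rpow (by positivity) hp' (by linarith)
    rw [one_div, Real.inv_rpow (by positivity)] at h2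
    have h3 : 0 < (2 * R) ^ α := by positivity
    rw [← div_le_iff₀' h3, div_eq_inv_mul]
    exact (mul_le_mul_of_nonneg_right h2 hT).trans h1
  have hcase : 1 / (2 * R) ≤ |p| ∨ 1 / (2 * R) ≤ |q| := by
    by_contra! h
    have h1 := mul_self_lt_mul_self (abs_nonneg p) h.1
    have h2 := mul_self_lt_mul_self (abs_nonneg q) h.2
    rw [abs_mul_abs_self] at h1 h2
    have e : 1 / (2 * R) * (1 / (2 * R)) = 1 / 4 * (1 / R ^ 2) := by field_simp; norm_num
    have : 0 < 1 / R ^ 2 := by positivity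
    rw [e] at h1 h2
    nlinarith
  have hconst : ∑ _x ∈ Icc (-N + 1) N, (2 * R) ^ α * C = 2 * ((2 * R) ^ α * C) * N := by
    rw [sum_const, nsmul_eq_mul, card_Icc_centred hN]; ring
  rw [← hconst]
  rcases hcase with h | h
  · rw [sum_product_right]
    exact sum_le_sum fun y _ => hline p (q * ((y : ℝ) - 1 / 2)) hp h
  · rw [sum_product]
    refine sum_le_sum fun x _ => ?_
    have := hline q (p * ((x : ℝ) - 1 / 2)) hq h
    simp only [add_comm _ (p * ((x : ℝ) - 1 / 2))] at this
    exact this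

/-- The sign of the affine form shows that the spectral gap is at most of order
`N ^ (-(α + 1))`. -/
lemma exists_metroDirichlet2_le_div_rpow_mul (α : ℝ) (hα : 1 < α) (R : ℝ) (hR : 1 ≤ R) :
    ∃ C : ℝ, 0 < C ∧ ∀ (p q : ℝ) (N : ℤ), |p| ≤ R → |q| ≤ R → 1 / R ^ 2 ≤ p ^ 2 + q ^ 2 →
      1 ≤ N → ∃ u : ℤ × ℤ → ℝ,
      0 < metroVar2 (Icc (-N + 1) N ×ˢ Icc (-N + 1) N)
        (fun k => (1 + |centredForm p q k|) ^ α) u ∧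
      metroDirichlet2 (Icc (-N + 1) N ×ˢ Icc (-N + 1) N)
        (fun k => (1 + |centredForm p q k|) ^ α) u ≤
      C / (N : ℝ) ^ (α + 1) * metroVar2 (Icc (-N + 1) N ×ˢ Icc (-N + 1) N)
        (fun k => (1 + |centredForm p q k|) ^ α) u := by
  obtain ⟨C, hC, hsum⟩ := exists_sum_inv_rpow_le α hα R hR
  have hα0 : 0 < α := by linarith
  have hR0 : 0 < R := by linarith
  set c0 := (1 / (4 * R)) ^ α * (1 / (8 * R ^ 4)) with hc0
  have hc0' : 0 < c0 := by positivity
  set B := (1 + R) ^ (2 * α) with hB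
  have hB0 : 0 < B := by positivity
  refine ⟨2 * B * C / c0, by positivity, fun p q N hp hq hpq hN => ?_⟩
  have hN' : (1 : ℝ) ≤ N := by exact_mod_cast hN
  have hN0 : (0 : ℝ) < N := by linarith
  have hinv := hsum p q N hp hq hpq hN
  have hmass := le_sum_abs_centredForm_rpow hα0 hR hN hp hq hpq
  set F : ℤ × ℤ → ℝ := fun k => (1 + |centredForm p q k|) ^ α with hFd
  have hF : ∀ k, 0 < F k := one_add_abs_centredForm_rpow_pos α p q
  set u : ℤ × ℤ → ℝ := fun k => Real.sign (centredForm p q k) with hu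
  have hE := sum_edges_eq_metroDirichlet2 F hF u (-N + 1) N (by omega)
  set box := Icc (-N + 1) N ×ˢ Icc (-N + 1) N with hbox
  set Z := ∑ k ∈ box, F k with hZd
  have hZle : c0 * (N : ℝ) ^ (α + 2) ≤ Z :=
    hmass.trans
      (sum_le_sum fun k _ => Real.rpow_le_rpow (abs_nonneg _) (by linarith) hα0.le)
  have hZ : 0 < Z := lt_of_lt_of_le (by positivity) hZle
  have hedge : ∀ k l : ℤ × ℤ, ∀ r, |r| ≤ R → centredForm p q l = centredForm p q k + r →
      (u l - u k) ^ 2 * min (F k) (F l) ≤ 4 * B * (1 / F k) := by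
    intro k l r hr hl
    have := sq_sign_sub_mul_rpow_le hα0.le (s := centredForm p q k) hr
    rw [← hl] at this
    exact (mul_le_mul_of_nonneg_left (min_le_left _ _) (sq_nonneg _)).trans this
  have hD : 4 * Z * metroDirichlet2 box F u ≤ 8 * B * (C * N) := by
    rw [← hE]
    have hnn : ∀ k, 0 ≤ 4 * B * (1 / F k) := fun k => by have := hF k; positivity
    have h1 : (∑ y ∈ Icc (-N + 1) N, ∑ x ∈ Icc (-N + 1) N, if x + 1 ∈ Icc (-N + 1) N then
        (u (x + 1, y) - u (x, y)) ^ 2 * min (F (x, y)) (F (x + 1, y)) else 0) ≤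
        ∑ k ∈ box, 4 * B * (1 / F k) := by
      rw [hbox, sum_product_right]
      refine sum_le_sum fun y _ => sum_le_sum fun x _ => ?_
      split_ifs
      · exact hedge (x, y) (x + 1, y) p hp (by unfold centredForm; push_cast; ring)
      · exact hnn _
    have h2 : (∑ x ∈ Icc (-N + 1) N, ∑ y ∈ Icc (-N + 1) N, if y + 1 ∈ Icc (-N + 1) N then
        (u (x, y + 1) - u (x, y)) ^ 2 * min (F (x, y)) (F (x, y + 1)) else 0) ≤
        ∑ k ∈ box, 4 * B * (1 / F k) := by
      rw [hbox, sum_product]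
      refine sum_le_sum fun y _ => sum_le_sum fun x _ => ?_
      split_ifs
      · exact hedge _ _ q hq (by unfold centredForm; push_cast; ring)
      · exact hnn _
    rw [← mul_sum] at h1 h2
    nlinarith [mul_le_mul_of_nonneg_left hinv hB0.le]
  have hmean : ∑ l ∈ box, u l * metroPi2 box F l = 0 := by
    have href : ∀ k : ℤ × ℤ, centredForm p q (1 - k.1, 1 - k.2) = -centredForm p q k := by
      intro k; unfold centredForm; push_cast; ring
    refine sum_involution (fun k _ => (1 - k.1, 1 - k.2)) (fun k _ => ?_) (fun k _ _ h => ?_)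
      (fun k hk => ?_) (fun k _ => by simp)
    · simp only [hu, metroPi2, hFd, href, Real.sign_neg, abs_neg]
      ring
    · have := congrArg Prod.fst h
      dsimp only at this
      omega
    · simp only [hbox, mem_product, mem_Icc] at *
      omega
  have hV : c0 * (N : ℝ) ^ (α + 2) ≤ metroVar2 box F u * Z := by
    unfold metroVar2
    rw [hmean, sum_mul]
    refine hmass.trans (sum_le_sum fun k _ => ?_)
    rw [sub_zero, metroPi2, ← hZd, mul_assoc, div_mul_cancel₀ _ hZ.ne']
    rcases eq_or_ne (centredForm p q k) 0 with h | h
    · rw [h, abs_zero, Real.zero_rpow hα0.ne']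
      have := hF k
      positivity
    · have : u k ^ 2 = 1 := by
        rcases Real.sign_apply_eq_of_ne_zero _ h with h' | h' <;> simp [hu, h']
      rw [this, one_mul]
      exact Real.rpow_le_rpow (abs_nonneg _) (by linarith) hα0.le
  have e2 : (N : ℝ) ^ (α + 2) = (N : ℝ) ^ (α + 1) * N := by
    rw [← Real.rpow_add_one hN0.ne']; congr 1; ring
  have hpow : 0 < (N : ℝ) ^ (α + 1) := by positivity
  set V := metroVar2 box F u
  set D := metroDirichlet2 box F u
  refine ⟨u, pos_of_mul_pos_left (lt_of_lt_of_le (by positivity) hV) hZ.le, ?_⟩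
  change D ≤ _ * V
  rw [div_div, div_mul_eq_mul_div, le_div_iff₀ (by positivity)]
  refine le_of_mul_le_mul_right ?_ (mul_pos hZ hN0)
  rw [e2] at hV
  calc D * (c0 * (N : ℝ) ^ (α + 1)) * (Z * N)
      = (4 * Z * D) / 4 * (c0 * ((N : ℝ) ^ (α + 1) * N)) := by ring
    _ ≤ (8 * B * (C * N)) / 4 * (V * Z) := by gcongr
    _ = _ := by ring

/-- valley effect, `α > 1`: for the target proportional to
`(1 + A·d((x₁-1/2)/N,(x₂-1/2)/N), L))^α` with `L = {a·z₁+b·z₂=0}`,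
`a²+b²=1`, and `εA ≤ N ≤ A/ε`, the spectral gap on `{-N+1,…,N}²` is of order
`1/N^{α+1}`. -/
theorem gap_valley_supercritical (α : ℝ) (hα : 1 < α)
    (ε : ℝ) (hε0 : 0 < ε) (hε1 : ε ≤ 1) :
    ∃ c C : ℝ, 0 < c ∧ 0 < C ∧
    ∀ (a b A : ℝ) (N : ℤ), a ^ 2 + b ^ 2 = 1 → 0 < A → 1 ≤ N →
      ε * A ≤ (N : ℝ) → (N : ℝ) ≤ A / ε →
      c / (N : ℝ) ^ (α + 1) ≤
        metroGap2 (Finset.Icc (-N + 1) N ×ˢ Finset.Icc (-N + 1) N)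
          (fun k => (1 + A * |a * ((k.1 : ℝ) - 1 / 2) / (N : ℝ) +
            b * ((k.2 : ℝ) - 1 / 2) / (N : ℝ)|) ^ α) ∧
      metroGap2 (Finset.Icc (-N + 1) N ×ˢ Finset.Icc (-N + 1) N)
          (fun k => (1 + A * |a * ((k.1 : ℝ) - 1 / 2) / (N : ℝ) +
            b * ((k.2 : ℝ) - 1 / 2) / (N : ℝ)|) ^ α) ≤ C / (N : ℝ) ^ (α + 1) := by
  have hR : 1 ≤ 1 / ε := by rw [le_div_iff₀ hε0]; linarith
  obtain ⟨c, hc, hlow⟩ := exists_div_rpow_mul_metroVar2_le α hα (1 / ε) hR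
  obtain ⟨C, hC, hup⟩ := exists_metroDirichlet2_le_div_rpow_mul α hα (1 / ε) hR
  refine ⟨c, C, hc, hC, fun a b A N hab hA hN hle hge => ?_⟩
  have hN' : (1 : ℝ) ≤ N := by exact_mod_cast hN
  have hN0 : (0 : ℝ) < N := by linarith
  set κ := A / N with hκ
  have hκ0 : 0 < κ := by positivity
  have hκle : κ ≤ 1 / ε := by
    rw [hκ, div_le_div_iff₀ hN0 hε0]; linarith
  have hκge : ε ≤ κ := by
    rw [hκ, le_div_iff₀ hN0, mul_comm]
    exact (le_div_iff₀ hε0).1 hge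
  have hF : (fun k : ℤ × ℤ => (1 + A * |a * ((k.1 : ℝ) - 1 / 2) / (N : ℝ) +
      b * ((k.2 : ℝ) - 1 / 2) / (N : ℝ)|) ^ α) =
      fun k => (1 + |centredForm (κ * a) (κ * b) k|) ^ α := by
    funext k
    rw [← abs_of_pos hA, ← abs_mul]
    congr 3
    unfold centredForm
    rw [hκ]
    ring
  rw [hF]
  have hp : |κ * a| ≤ 1 / ε := by
    rw [abs_mul, abs_of_pos hκ0]
    nlinarith [abs_le_one_iff_mul_self_le_one.2 (by nlinarith : a * a ≤ 1), abs_nonneg a]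
  have hq : |κ * b| ≤ 1 / ε := by
    rw [abs_mul, abs_of_pos hκ0]
    nlinarith [abs_le_one_iff_mul_self_le_one.2 (by nlinarith : b * b ≤ 1), abs_nonneg b]
  have hpq : 1 / (1 / ε) ^ 2 ≤ (κ * a) ^ 2 + (κ * b) ^ 2 := by
    have e1 : 1 / (1 / ε) ^ 2 = ε ^ 2 := by field_simp
    have e2 : (κ * a) ^ 2 + (κ * b) ^ 2 = κ ^ 2 := by linear_combination κ ^ 2 * hab
    rw [e1, e2]
    gcongr
  have hpos := one_add_abs_centredForm_rpow_pos α (κ * a) (κ * b)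
  obtain ⟨u, hu, hDu⟩ := hup (κ * a) (κ * b) N hp hq hpq hN
  constructor
  · refine le_csInf ⟨_, u, hu.ne', rfl⟩ ?_
    rintro r ⟨v, hv, rfl⟩
    rw [le_div_iff₀ ((metroVar2_nonneg _ _ v hpos).lt_of_ne' hv)]
    exact hlow (κ * a) (κ * b) N hp hq hpq hN v
  · refine le_trans ?_ ((div_le_iff₀ hu).2 hDu)
    refine csInf_le ⟨0, ?_⟩ ⟨u, hu.ne', rfl⟩
    rintro r ⟨v, hv, rfl⟩
    exact div_nonneg (metroDirichlet2_nonneg _ _ v hpos) (metroVar2_nonneg _ _ v hpos)
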